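/- Let C₀, C₁ ∈ ℝ. The initial value problem D^{0.7, 0} y(x) − D^{0.5, 0} y(x) = 0 for x > 0, with initial conditions (I^{0.3} y)(0+) = C₀ and (I^{0.5} y)(0+) = C₁, has a solution y in Ω^{0.7}_0 ∩ Ω^{0.5}_0 if and only if C₁ = 0. -/

import Mathlib

open Real MeasureTheory Filter Set Topology

/-- The Riemann–Liouville fractional integral `I^α` (with `I^0 f = f`). -/
noncomputable def RL (α : ℝ) (f : ℝ → ℝ) : ℝ → ℝ :=
  if α = 0 then f
  else fun x => (1 / Real.Gamma α) * ∫ t in (0:ℝ)..x, (x - t) ^ (α - 1) * f t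

/-- The space `C_γ`: `f x = x ^ p * f₁ x` on `(0,∞)` for some `p > γ` and `f₁`
continuous on `[0,∞)`. -/
def SpaceC (γ : ℝ) (f : ℝ → ℝ) : Prop :=
  ∃ p : ℝ, γ < p ∧ ∃ f₁ : ℝ → ℝ,
    ContinuousOn f₁ (Set.Ici 0) ∧ ∀ x > 0, f x = x ^ p * f₁ x

/-- The space `C^m_γ`: `f` is `m` times differentiable on `(0,∞)` and `f^(m) ∈ C_γ`. -/
def SpaceCm (m : ℕ) (γ : ℝ) (f : ℝ → ℝ) : Prop :=
  (∀ k < m, DifferentiableOn ℝ (iteratedDerivWithin k f (Set.Ioi 0)) (Set.Ioi 0)) ∧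
  SpaceC γ (iteratedDerivWithin m f (Set.Ioi 0))

/-- The Laplace convolution `(f ⋆ g) x = ∫_0^x f (x - t) * g t dt`. -/
noncomputable def laplaceConv (f g : ℝ → ℝ) : ℝ → ℝ :=
  fun x => ∫ t in (0:ℝ)..x, f (x - t) * g t

/-- The generalized Riemann–Liouville (Hilfer) fractional derivative of order `α`
(`n - 1 < α ≤ n`) and type `β`. -/
noncomputable def hilferD (n : ℕ) (α β : ℝ) (f : ℝ → ℝ) : ℝ → ℝ :=
  RL (β * (n - α)) (iteratedDerivWithin n (RL ((1 - β) * (n - α)) f) (Set.Ioi 0))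

/-- The space `Ω^α_β` (for `n - 1 < α ≤ n`): `y ∈ C_{-1}` with
`I^{(1-β)(n-α)} y ∈ C^n_{-1}`. -/
def OmegaSpace (n : ℕ) (α β : ℝ) (y : ℝ → ℝ) : Prop :=
  SpaceC (-1) y ∧ SpaceCm n (-1) (RL ((1 - β) * (n - α)) y)

/-- The multivariate Mittag-Leffler function
`E_{(a_1,…,a_n),b}(z_1,…,z_n)`, with the double series
`Σ_k Σ_{l_1+⋯+l_n=k}` rewritten as a sum over all multi-indices. -/
noncomputable def mittagLeffler {n : ℕ} (a : Fin n → ℝ) (b : ℝ) (z : Fin n → ℝ) : ℝ :=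
  ∑' l : Fin n → ℕ,
    ((Nat.factorial (∑ j, l j) : ℝ) / ∏ j, (Nat.factorial (l j) : ℝ)) *
      (∏ j, z j ^ l j) / Real.Gamma (b + ∑ j, a j * l j)

/-- The scaled Beta integral over the reals. -/
theorem integral_sub_rpow_mul_rpow {a b x : ℝ} (ha : 0 < a) (hb : 0 < b) (hx : 0 < x) :
    ∫ t in (0:ℝ)..x, (x - t) ^ (a - 1) * t ^ (b - 1) =
      Real.Gamma a * Real.Gamma b / Real.Gamma (a + b) * x ^ (a + b - 1) := by
  have key := Complex.betaIntegral_scaled (b : ℂ) (a : ℂ) hx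
  rw [Complex.betaIntegral_eq_Gamma_mul_div _ _ (by simpa) (by simpa)] at key
  have hcongr : ∫ t in (0:ℝ)..x, (t : ℂ) ^ ((b : ℂ) - 1) * ((x : ℂ) - t) ^ ((a : ℂ) - 1) =
      ∫ t in (0:ℝ)..x, (((x - t) ^ (a - 1) * t ^ (b - 1) : ℝ) : ℂ) := by
    refine intervalIntegral.integral_congr fun t ht => ?_
    rw [uIcc_of_le hx.le] at ht
    simp only [Complex.ofReal_mul, Complex.ofReal_cpow ht.1,
      Complex.ofReal_cpow (sub_nonneg.2 ht.2)]
    push_cast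
    ring
  rw [hcongr, intervalIntegral.integral_ofReal] at key
  have hpow : (x : ℂ) ^ ((b : ℂ) + a - 1) = ((x ^ (a + b - 1) : ℝ) : ℂ) := by
    rw [Complex.ofReal_cpow hx.le]
    push_cast
    ring_nf
  rw [hpow, ← Complex.ofReal_add, Complex.Gamma_ofReal, Complex.Gamma_ofReal,
    Complex.Gamma_ofReal] at key
  norm_cast at key
  rw [key, add_comm b a]
  ring

theorem intervalIntegrable_sub_rpow_mul_rpow {a b x : ℝ} (ha : 0 < a) (hb : 0 < b)
    (hx : 0 < x) :
    IntervalIntegrable (fun t => (x - t) ^ (a - 1) * t ^ (b - 1)) volume 0 x := by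
  refine intervalIntegral.intervalIntegrable_of_integral_ne_zero ?_
  rw [integral_sub_rpow_mul_rpow ha hb hx]
  have := Real.Gamma_pos_of_pos ha
  have := Real.Gamma_pos_of_pos hb
  have := Real.Gamma_pos_of_pos (add_pos ha hb)
  positivity

theorem integral_sub_rpow_mul_sub_rpow {a b s x : ℝ} (ha : 0 < a) (hb : 0 < b) (hx : s < x) :
    ∫ t in s..x, (x - t) ^ (a - 1) * (t - s) ^ (b - 1) =
      Real.Gamma a * Real.Gamma b / Real.Gamma (a + b) * (x - s) ^ (a + b - 1) := by
  rw [← integral_sub_rpow_mul_rpow ha hb (sub_pos.2 hx)]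
  have := intervalIntegral.integral_comp_sub_right (a := s) (b := x)
    (fun t => (x - s - t) ^ (a - 1) * t ^ (b - 1)) s
  simpa using this

theorem SpaceC.add {γ : ℝ} {f g : ℝ → ℝ} (hf : SpaceC γ f) (hg : SpaceC γ g) :
    SpaceC γ (fun x => f x + g x) := by
  obtain ⟨p, hp, f₁, hf₁, hf⟩ := hf
  obtain ⟨q, hq, g₁, hg₁, hg⟩ := hg
  have hcont : ∀ r : ℝ, 0 ≤ r → ContinuousOn (fun x : ℝ => x ^ r) (Ici 0) := fun r hr =>
    (Real.continuous_rpow_const hr).continuousOn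
  refine ⟨min p q, lt_min hp hq, fun x => x ^ (p - min p q) * f₁ x + x ^ (q - min p q) * g₁ x,
    ((hcont _ (by simp)).mul hf₁).add ((hcont _ (by simp)).mul hg₁), fun x hx => ?_⟩
  simp only [hf x hx, hg x hx]
  rw [mul_add, ← mul_assoc, ← mul_assoc, ← Real.rpow_add hx,
    ← Real.rpow_add hx]
  ring_nf

theorem SpaceC.const_mul {γ : ℝ} {f : ℝ → ℝ} (hf : SpaceC γ f) (c : ℝ) :
    SpaceC γ (fun x => c * f x) := by
  obtain ⟨p, hp, f₁, hf₁, hf⟩ := hf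
  exact ⟨p, hp, fun x => c * f₁ x, continuousOn_const.mul hf₁, fun x hx => by
    simp only [hf x hx]
    ring⟩

theorem SpaceC.congr {γ : ℝ} {f g : ℝ → ℝ} (hf : SpaceC γ f) (h : ∀ x > 0, g x = f x) :
    SpaceC γ g := by
  obtain ⟨p, hp, f₁, hf₁, hf⟩ := hf
  exact ⟨p, hp, f₁, hf₁, fun x hx => by rw [h x hx, hf x hx]⟩

theorem ContinuousOn.spaceC {γ : ℝ} (hγ : γ < 0) {f : ℝ → ℝ} (hf : ContinuousOn f (Ici 0)) :
    SpaceC γ f :=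
  ⟨0, hγ, f, hf, fun x _ => by simp⟩

theorem spaceC_rpow {γ p : ℝ} (hp : γ < p) : SpaceC γ (fun x => x ^ p) :=
  ⟨p, hp, fun _ => 1, continuousOn_const, fun x _ => by simp⟩

theorem SpaceC.continuousOn {γ : ℝ} {f : ℝ → ℝ} (hf : SpaceC γ f) : ContinuousOn f (Ioi 0) := by
  obtain ⟨p, -, f₁, hf₁, hf⟩ := hf
  refine ContinuousOn.congr (f := fun x => x ^ p * f₁ x) ?_ fun x hx => hf x hx
  exact (continuousOn_id.rpow_const fun x hx => Or.inl (ne_of_gt hx)).mul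
    (hf₁.mono Ioi_subset_Ici_self)

theorem SpaceC.intervalIntegrable {f : ℝ → ℝ} (hf : SpaceC (-1) f) {a x : ℝ} (ha : 0 < a)
    (hx : 0 < x) : IntervalIntegrable (fun t => (x - t) ^ (a - 1) * f t) volume 0 x := by
  obtain ⟨p, hp, f₁, hf₁, hf⟩ := hf
  have h := (intervalIntegrable_sub_rpow_mul_rpow ha (b := p + 1) (by linarith) hx).mul_continuousOn
    (hf₁.mono (by rw [uIcc_of_le hx.le]; exact Icc_subset_Ici_self))
  refine h.congr fun t ht => ?_
  rw [uIoc_of_le hx.le] at ht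
  simp only [hf t ht.1, add_sub_cancel_right]
  ring

theorem RL_zero (f : ℝ → ℝ) : RL 0 f = f :=
  if_pos rfl

theorem RL_apply {a : ℝ} (ha : 0 < a) (f : ℝ → ℝ) (x : ℝ) :
    RL a f x = (1 / Real.Gamma a) * ∫ t in (0:ℝ)..x, (x - t) ^ (a - 1) * f t := by
  rw [RL, if_neg ha.ne']

theorem RL_congr {a x : ℝ} (ha : 0 < a) (hx : 0 < x) {f g : ℝ → ℝ} (h : ∀ t > 0, f t = g t) :
    RL a f x = RL a g x := by
  rw [RL_apply ha, RL_apply ha]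
  congr 1
  refine intervalIntegral.integral_congr_ae (.of_forall fun t ht => ?_)
  rw [uIoc_of_le hx.le] at ht
  rw [h t ht.1]

theorem RL_add {a x : ℝ} (ha : 0 < a) (hx : 0 < x) {f g : ℝ → ℝ} (hf : SpaceC (-1) f)
    (hg : SpaceC (-1) g) : RL a (fun t => f t + g t) x = RL a f x + RL a g x := by
  simp only [RL_apply ha, mul_add]
  rw [intervalIntegral.integral_add (hf.intervalIntegrable ha hx) (hg.intervalIntegrable ha hx),
    mul_add]

theorem RL_const_mul {a : ℝ} (ha : 0 < a) (c : ℝ) (f : ℝ → ℝ) (x : ℝ) :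
    RL a (fun t => c * f t) x = c * RL a f x := by
  simp only [RL_apply ha]
  simp_rw [mul_left_comm _ c]
  rw [intervalIntegral.integral_const_mul]
  ring

/-- `I^a` maps `t ^ (b - 1) / Γ(b)` to `x ^ (a + b - 1) / Γ(a + b)`. -/
theorem RL_rpow {a b x : ℝ} (ha : 0 < a) (hb : 0 < b) (hx : 0 < x) :
    RL a (fun t => (1 / Real.Gamma b) * t ^ (b - 1)) x =
      (1 / Real.Gamma (a + b)) * x ^ (a + b - 1) := by
  rw [RL_const_mul ha, RL_apply ha, integral_sub_rpow_mul_rpow ha hb hx]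
  have := Real.Gamma_pos_of_pos ha
  have := Real.Gamma_pos_of_pos hb
  field_simp

/-- The semigroup property `I^a I^b = I^(a+b)` of the fractional integral. -/
theorem RL_RL {a b x : ℝ} (ha : 0 < a) (hb : 0 < b) (hx : 0 < x) {f : ℝ → ℝ}
    (hf : SpaceC (-1) f) : RL a (RL b f) x = RL (a + b) f x := by
  set μ := volume.restrict (Ioc 0 x)
  set B := Real.Gamma a * Real.Gamma b / Real.Gamma (a + b)
  have hfm : AEStronglyMeasurable f μ :=
    (hf.continuousOn.mono fun t ht => ht.1).aestronglyMeasurable measurableSet_Ioc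
  let k : ℝ → ℝ → ℝ := fun s t => (x - t) ^ (a - 1) * (t - s) ^ (b - 1)
  let F : ℝ → ℝ → ℝ := fun s t => (Ioi s).indicator (k s) t * f s
  have hk_int : ∀ s ∈ Ioo 0 x, ∫ t, (Ioi s).indicator (k s) t ∂μ = B * (x - s) ^ (a + b - 1) := by
    intro s hs
    rw [setIntegral_indicator measurableSet_Ioi, Ioc_inter_Ioi, max_eq_right hs.1.le,
      ← intervalIntegral.integral_of_le hs.2.le, integral_sub_rpow_mul_sub_rpow ha hb hs.2]
  have hIoo : ∀ᵐ s ∂μ, s ∈ Ioo 0 x := by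
    rw [show μ = volume.restrict (Ioo 0 x) from restrict_Ioo_eq_restrict_Ioc.symm]
    exact ae_restrict_mem measurableSet_Ioo
  have hF_meas : AEStronglyMeasurable (Function.uncurry F) (μ.prod μ) := by
    suffices h : AEStronglyMeasurable (fun z : ℝ × ℝ => (Ioi z.1).indicator (k z.1) z.2)
        (μ.prod μ) from h.mul hfm.comp_fst
    have : Measurable fun z : ℝ × ℝ => ({z | z.1 < z.2} : Set (ℝ × ℝ)).indicator
        (fun z => k z.1 z.2) z := by
      refine Measurable.indicator ?_ (measurableSet_lt measurable_fst measurable_snd)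
      fun_prop
    exact this.aestronglyMeasurable
  have hF_int : Integrable (Function.uncurry F) (μ.prod μ) := by
    rw [integrable_prod_iff hF_meas]
    constructor
    · filter_upwards [hIoo] with s hs
      suffices h : Integrable ((Ioi s).indicator (k s)) μ from h.mul_const (f s)
      refine not_imp_comm.1 integral_undef ?_
      rw [hk_int s hs]
      have := Real.Gamma_pos_of_pos ha
      have := Real.Gamma_pos_of_pos hb
      have := Real.Gamma_pos_of_pos (add_pos ha hb)
      have := sub_pos.2 hs.2
      positivity
    · have h := ((hf.intervalIntegrable (add_pos ha hb) hx).norm.const_mul B)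
      rw [intervalIntegrable_iff_integrableOn_Ioc_of_le hx.le] at h
      refine Integrable.congr h ?_
      filter_upwards [hIoo] with s hs
      have hnn : ∀ᵐ t ∂μ, ‖Function.uncurry F (s, t)‖ = (Ioi s).indicator (k s) t * ‖f s‖ := by
        filter_upwards [ae_restrict_mem measurableSet_Ioc] with t ht
        simp only [Function.uncurry, F, norm_mul]
        congr 1
        refine Real.norm_of_nonneg (indicator_apply_nonneg fun hst => ?_)
        exact mul_nonneg (rpow_nonneg (sub_nonneg.2 ht.2) _)
          (rpow_nonneg (sub_nonneg.2 (le_of_lt hst)) _)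
      rw [integral_congr_ae hnn, integral_mul_const, hk_int s hs, norm_mul,
        Real.norm_of_nonneg (rpow_nonneg (sub_nonneg.2 hs.2.le) _)]
      ring
  have hswap := integral_integral_swap hF_int
  have hleft : ∫ s, ∫ t, F s t ∂μ ∂μ =
      B * ∫ s in (0:ℝ)..x, (x - s) ^ (a + b - 1) * f s := by
    rw [intervalIntegral.integral_of_le hx.le, ← integral_const_mul]
    refine integral_congr_ae ?_
    filter_upwards [hIoo] with s hs
    rw [integral_mul_const, hk_int s hs, mul_assoc]
  have hright : ∫ t, ∫ s, F s t ∂μ ∂μ =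
      ∫ t in (0:ℝ)..x, (x - t) ^ (a - 1) * ∫ s in (0:ℝ)..t, (t - s) ^ (b - 1) * f s := by
    rw [intervalIntegral.integral_of_le hx.le]
    refine setIntegral_congr_fun measurableSet_Ioc fun t ht => ?_
    have hF : ∀ s, F s t =
        (Iio t).indicator (fun s => (x - t) ^ (a - 1) * ((t - s) ^ (b - 1) * f s)) s := by
      intro s
      by_cases hst : s < t <;> simp [F, k, hst, mul_assoc]
    simp only [hF]
    rw [setIntegral_indicator measurableSet_Iio,
      show Ioc 0 x ∩ Iio t = Ioo 0 t by
        ext s; exact ⟨fun h => ⟨h.1.1, h.2⟩, fun h => ⟨⟨h.1, h.2.le.trans ht.2⟩, h.2⟩⟩,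
      ← integral_Ioc_eq_integral_Ioo, ← intervalIntegral.integral_of_le ht.1.le,
      intervalIntegral.integral_const_mul]
  rw [hleft, hright] at hswap
  simp only [RL_apply ha, RL_apply hb, RL_apply (add_pos ha hb)]
  simp_rw [mul_left_comm _ (1 / Real.Gamma b)]
  rw [intervalIntegral.integral_const_mul, ← hswap]
  have := Real.Gamma_pos_of_pos ha
  have := Real.Gamma_pos_of_pos hb
  simp only [B]
  field_simp

theorem RL_exp {a : ℝ} (ha : 0 < a) (x : ℝ) : RL a Real.exp x =
    Real.exp x * ((1 / Real.Gamma a) * ∫ s in (0:ℝ)..x, s ^ (a - 1) * Real.exp (-s)) := by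
  have h := intervalIntegral.integral_comp_sub_left (a := 0) (b := x)
    (fun s => s ^ (a - 1) * Real.exp (x - s)) x
  simp only [sub_sub_cancel, sub_self, sub_zero] at h
  rw [RL_apply ha, h, mul_left_comm, ← intervalIntegral.integral_const_mul (Real.exp x)]
  congr 1
  refine intervalIntegral.integral_congr fun s _ => ?_
  rw [sub_eq_add_neg x s, Real.exp_add]
  ring

theorem intervalIntegrable_rpow_mul_exp_neg {a : ℝ} (ha : 0 < a) (u v : ℝ) :
    IntervalIntegrable (fun s => s ^ (a - 1) * Real.exp (-s)) volume u v :=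
  (intervalIntegral.intervalIntegrable_rpow' (by linarith)).mul_continuousOn
    (by fun_prop)

theorem continuous_RL_exp {a : ℝ} (ha : 0 < a) : Continuous (RL a Real.exp) := by
  rw [funext (RL_exp ha)]
  exact Real.continuous_exp.mul (continuous_const.mul
    (intervalIntegral.continuous_primitive (intervalIntegrable_rpow_mul_exp_neg ha) 0))

/-- The formal derivative of `I^a exp`; on `(0,∞)` it plays the role of `I^(a-1) exp`. -/
noncomputable def derivRLExp (a x : ℝ) : ℝ :=
  (1 / Real.Gamma a) * x ^ (a - 1) + RL a Real.exp x

theorem hasDerivAt_RL_exp {a x : ℝ} (ha : 0 < a) (hx : 0 < x) :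
    HasDerivAt (RL a Real.exp) (derivRLExp a x) x := by
  have hcont : ContinuousOn (fun s : ℝ => s ^ (a - 1) * Real.exp (-s)) (Ioi 0) :=
    (continuousOn_id.rpow_const fun s hs => Or.inl (ne_of_gt hs)).mul (by fun_prop)
  have h := intervalIntegral.integral_hasDerivAt_right
    (intervalIntegrable_rpow_mul_exp_neg ha 0 x)
    (hcont.stronglyMeasurableAtFilter isOpen_Ioi x hx)
    (hcont.continuousAt (Ioi_mem_nhds hx))
  have h' := (Real.hasDerivAt_exp x).mul (h.const_mul (1 / Real.Gamma a))
  rw [funext (RL_exp ha)]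
  refine h'.congr_deriv ?_
  rw [derivRLExp, RL_exp ha, add_comm, mul_left_comm (Real.exp x), mul_left_comm (Real.exp x),
    ← Real.exp_add, add_neg_cancel, Real.exp_zero]
  ring

theorem RL_one_exp (x : ℝ) : RL 1 Real.exp x = Real.exp x - 1 := by
  rw [RL_apply one_pos]
  simp

theorem spaceC_exp : SpaceC (-1) Real.exp :=
  Real.continuous_exp.continuousOn.spaceC (by norm_num)

theorem spaceC_RL_exp {a : ℝ} (ha : 0 < a) : SpaceC (-1) (RL a Real.exp) :=
  (continuous_RL_exp ha).continuousOn.spaceC (by norm_num)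

theorem spaceC_derivRLExp {a : ℝ} (ha : 0 < a) : SpaceC (-1) (derivRLExp a) :=
  ((spaceC_rpow (by linarith)).const_mul _).add (spaceC_RL_exp ha)

theorem RL_derivRLExp {a b x : ℝ} (ha : 0 < a) (hb : 0 < b) (hx : 0 < x) :
    RL b (derivRLExp a) x = derivRLExp (b + a) x := by
  have h := RL_add hb hx ((spaceC_rpow (p := a - 1) (by linarith)).const_mul (1 / Real.Gamma a))
    (spaceC_RL_exp ha)
  rw [RL_rpow hb ha hx, RL_RL hb ha hx spaceC_exp] at h
  exact h

theorem derivRLExp_one {x : ℝ} : derivRLExp 1 x = Real.exp x := by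
  simp [derivRLExp, RL_one_exp]

theorem derivRLExp_add_one {c x : ℝ} (hc : 0 < c) (hx : 0 < x) :
    derivRLExp (1 + c) x = RL c Real.exp x := by
  have h := RL_derivRLExp one_pos hc hx
  rw [add_comm 1 c, ← h]
  exact RL_congr hc hx fun t _ => derivRLExp_one

theorem spaceCm_one_of_hasDerivAt {γ : ℝ} {f g g' : ℝ → ℝ} (hfg : ∀ x > 0, f x = g x)
    (hg : ∀ x > 0, HasDerivAt g (g' x) x) (hg' : SpaceC γ g') :
    SpaceCm 1 γ f ∧ ∀ x > 0, iteratedDerivWithin 1 f (Ioi 0) x = g' x := by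
  have hf : ∀ x > 0, HasDerivWithinAt f (g' x) (Ioi 0) x := fun x hx =>
    (hg x hx).hasDerivWithinAt.congr hfg (hfg x hx)
  have hderiv : ∀ x > 0, iteratedDerivWithin 1 f (Ioi 0) x = g' x := fun x hx => by
    rw [iteratedDerivWithin_one, (hf x hx).derivWithin (uniqueDiffOn_Ioi 0 x hx)]
  refine ⟨⟨fun k hk x hx => ?_, hg'.congr hderiv⟩, hderiv⟩
  obtain rfl : k = 0 := by omega
  rw [iteratedDerivWithin_zero]
  exact (hf x hx).differentiableWithinAt

/-- If `g` has a finite limit at `0+`, then `I^a g` tends to `0` at `0+`. -/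
theorem tendsto_RL_nhds_zero {a c : ℝ} (ha : 0 < a) {g : ℝ → ℝ}
    (hg : Tendsto g (𝓝[>] (0:ℝ)) (𝓝 c)) : Tendsto (RL a g) (𝓝[>] (0:ℝ)) (𝓝 0) := by
  have hbound : ∀ᶠ t in 𝓝[>] (0:ℝ), ‖g t‖ ≤ ‖c‖ + 1 :=
    (hg.norm.eventually (gt_mem_nhds (lt_add_one ‖c‖))).mono fun _ h => h.le
  obtain ⟨δ, hδ, hsub⟩ := mem_nhdsGT_iff_exists_Ioo_subset.1 hbound
  have hlim : Tendsto (fun x : ℝ => (1 / Real.Gamma a) * ((‖c‖ + 1) * (x ^ a / a)))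
      (𝓝[>] (0:ℝ)) (𝓝 0) := by
    have h : Tendsto (fun x : ℝ => (1 / Real.Gamma a) * ((‖c‖ + 1) * (x ^ a / a)))
        (𝓝 (0:ℝ)) (𝓝 ((1 / Real.Gamma a) * ((‖c‖ + 1) * ((0:ℝ) ^ a / a)))) :=
      ((((Real.continuous_rpow_const ha.le).tendsto 0).div_const a).const_mul _).const_mul _
    rw [Real.zero_rpow ha.ne', zero_div, mul_zero, mul_zero] at h
    exact h.mono_left nhdsWithin_le_nhds
  refine squeeze_zero_norm' ?_ hlim
  filter_upwards [Ioo_mem_nhdsGT hδ] with x hx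
  have hΓ : 0 ≤ 1 / Real.Gamma a := (one_div_pos.2 (Real.Gamma_pos_of_pos ha)).le
  rw [RL_apply ha, norm_mul, Real.norm_of_nonneg hΓ]
  refine mul_le_mul_of_nonneg_left ?_ hΓ
  have hint : IntervalIntegrable (fun t => (‖c‖ + 1) * (x - t) ^ (a - 1)) volume 0 x := by
    have h := intervalIntegrable_sub_rpow_mul_rpow ha one_pos hx.1
    simp only [sub_self, Real.rpow_zero, mul_one] at h
    exact h.const_mul _
  have hval : ∫ t in (0:ℝ)..x, (‖c‖ + 1) * (x - t) ^ (a - 1) = (‖c‖ + 1) * (x ^ a / a) := by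
    have h := integral_sub_rpow_mul_rpow ha one_pos hx.1
    simp only [sub_self, Real.rpow_zero, mul_one, Real.Gamma_one, add_sub_cancel_right,
      Real.Gamma_add_one ha.ne'] at h
    rw [intervalIntegral.integral_const_mul, h]
    have := Real.Gamma_pos_of_pos ha
    field_simp
  rw [← hval]
  refine intervalIntegral.norm_integral_le_of_norm_le hx.1.le ?_ hint
  refine Filter.Eventually.of_forall fun t ht => ?_
  rw [norm_mul, Real.norm_of_nonneg (Real.rpow_nonneg (sub_nonneg.2 ht.2) _), mul_comm]
  exact mul_le_mul_of_nonneg_right (hsub ⟨ht.1, ht.2.trans_lt hx.2⟩)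
    (Real.rpow_nonneg (sub_nonneg.2 ht.2) _)

/-- `Σ_{j<5} I^(j/5 - 3/10) exp`, the solution of the initial value problem with `C₀ = 1`. -/
noncomputable def ivpSolution (x : ℝ) : ℝ :=
  derivRLExp 0.7 x + derivRLExp 0.9 x + RL 0.1 Real.exp x + RL 0.3 Real.exp x + RL 0.5 Real.exp x

/-- `Σ_{j<5} I^(j/5) exp`, which on `(0,∞)` is `I^(3/10)` of `ivpSolution`. -/
noncomputable def ivpIntegral (x : ℝ) : ℝ :=
  Real.exp x + RL 0.2 Real.exp x + RL 0.4 Real.exp x + RL 0.6 Real.exp x + RL 0.8 Real.exp x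

theorem spaceC_ivpSolution : SpaceC (-1) ivpSolution :=
  ((((spaceC_derivRLExp (by norm_num)).add (spaceC_derivRLExp (by norm_num))).add
    (spaceC_RL_exp (by norm_num))).add (spaceC_RL_exp (by norm_num))).add
    (spaceC_RL_exp (by norm_num))

theorem RL_ivpSolution {b x : ℝ} (hb : 0 < b) (hx : 0 < x) :
    RL b ivpSolution x = derivRLExp (b + 0.7) x + derivRLExp (b + 0.9) x +
      RL (b + 0.1) Real.exp x + RL (b + 0.3) Real.exp x + RL (b + 0.5) Real.exp x := by
  have h7 : SpaceC (-1) (derivRLExp 0.7) := spaceC_derivRLExp (by norm_num)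
  have h9 : SpaceC (-1) (derivRLExp 0.9) := spaceC_derivRLExp (by norm_num)
  have h1 : SpaceC (-1) (RL 0.1 Real.exp) := spaceC_RL_exp (by norm_num)
  have h3 : SpaceC (-1) (RL 0.3 Real.exp) := spaceC_RL_exp (by norm_num)
  have h5 : SpaceC (-1) (RL 0.5 Real.exp) := spaceC_RL_exp (by norm_num)
  unfold ivpSolution
  rw [RL_add hb hx (((h7.add h9).add h1).add h3) h5, RL_add hb hx ((h7.add h9).add h1) h3,
    RL_add hb hx (h7.add h9) h1, RL_add hb hx h7 h9, RL_derivRLExp (by norm_num) hb hx,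
    RL_derivRLExp (by norm_num) hb hx, RL_RL hb (by norm_num) hx spaceC_exp,
    RL_RL hb (by norm_num) hx spaceC_exp, RL_RL hb (by norm_num) hx spaceC_exp]

theorem RL_three_tenths_ivpSolution {x : ℝ} (hx : 0 < x) :
    RL 0.3 ivpSolution x = ivpIntegral x := by
  rw [RL_ivpSolution (by norm_num) hx, ivpIntegral, ← derivRLExp_one,
    ← derivRLExp_add_one (c := 0.2) (by norm_num) hx]
  norm_num

theorem RL_one_half_ivpSolution {x : ℝ} (hx : 0 < x) :
    RL 0.5 ivpSolution x = ivpIntegral x - 1 := by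
  have hexp : Real.exp x = RL 1 Real.exp x + 1 := by rw [RL_one_exp]; ring
  rw [RL_ivpSolution (by norm_num) hx, ivpIntegral, hexp,
    ← derivRLExp_add_one (c := 0.2) (by norm_num) hx,
    ← derivRLExp_add_one (c := 0.4) (by norm_num) hx]
  norm_num
  ring

theorem continuous_ivpIntegral : Continuous ivpIntegral :=
  (((Real.continuous_exp.add (continuous_RL_exp (by norm_num))).add
    (continuous_RL_exp (by norm_num))).add (continuous_RL_exp (by norm_num))).add
    (continuous_RL_exp (by norm_num))

theorem ivpIntegral_zero : ivpIntegral 0 = 1 := by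
  have h : ∀ a : ℝ, 0 < a → RL a Real.exp 0 = 0 := fun a ha => by simp [RL_apply ha]
  rw [ivpIntegral, h _ (by norm_num), h _ (by norm_num), h _ (by norm_num), h _ (by norm_num)]
  simp

theorem exists_hasDerivAt_ivpIntegral :
    ∃ v : ℝ → ℝ, SpaceC (-1) v ∧ ∀ x > 0, HasDerivAt ivpIntegral (v x) x :=
  ⟨_, (((spaceC_exp.add (spaceC_derivRLExp (by norm_num))).add
      (spaceC_derivRLExp (by norm_num))).add (spaceC_derivRLExp (by norm_num))).add
      (spaceC_derivRLExp (by norm_num)),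
    fun x hx => ((((Real.hasDerivAt_exp x).add (hasDerivAt_RL_exp (by norm_num) hx)).add
      (hasDerivAt_RL_exp (by norm_num) hx)).add (hasDerivAt_RL_exp (by norm_num) hx)).add
      (hasDerivAt_RL_exp (by norm_num) hx)⟩

/-- the initial value problem
`D^{0.7,0} y - D^{0.5,0} y = 0`, `(I^{0.3} y)(0+) = C₀`, `(I^{0.5} y)(0+) = C₁`,
has a solution `y ∈ Ω^{0.7}_0 ∩ Ω^{0.5}_0` if and only if `C₁ = 0`. -/
theorem motivating_example_ivp (C₀ C₁ : ℝ) :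
    (∃ y : ℝ → ℝ,
      OmegaSpace 1 0.7 0 y ∧ OmegaSpace 1 0.5 0 y ∧
      (∀ x > 0, hilferD 1 0.7 0 y x - hilferD 1 0.5 0 y x = 0) ∧
      Tendsto (RL 0.3 y) (𝓝[>] (0:ℝ)) (𝓝 C₀) ∧
      Tendsto (RL 0.5 y) (𝓝[>] (0:ℝ)) (𝓝 C₁)) ↔
    C₁ = 0 := by
  constructor
  · rintro ⟨y, ⟨hy, -⟩, -, -, h₀, h₁⟩
    refine tendsto_nhds_unique h₁ ((tendsto_RL_nhds_zero (a := 0.2) (by norm_num) h₀).congr' ?_)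
    filter_upwards [self_mem_nhdsWithin] with x hx
    rw [RL_RL (by norm_num) (by norm_num) hx hy]
    norm_num
  · rintro rfl
    obtain ⟨v, hv, hderiv⟩ := exists_hasDerivAt_ivpIntegral
    have h3 : ∀ x > 0, RL 0.3 (fun t => C₀ * ivpSolution t) x = C₀ * ivpIntegral x :=
      fun x hx => by rw [RL_const_mul (by norm_num), RL_three_tenths_ivpSolution hx]
    have h5 : ∀ x > 0, RL 0.5 (fun t => C₀ * ivpSolution t) x = C₀ * (ivpIntegral x - 1) :=
      fun x hx => by rw [RL_const_mul (by norm_num), RL_one_half_ivpSolution hx]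
    have e3 : (1 - 0) * (((1 : ℕ) : ℝ) - 0.7) = 0.3 := by norm_num
    have e5 : (1 - 0) * (((1 : ℕ) : ℝ) - 0.5) = 0.5 := by norm_num
    obtain ⟨hC3, hD3⟩ := spaceCm_one_of_hasDerivAt h3 (fun x hx => (hderiv x hx).const_mul C₀)
      (hv.const_mul C₀)
    obtain ⟨hC5, hD5⟩ := spaceCm_one_of_hasDerivAt h5
      (fun x hx => ((hderiv x hx).sub_const 1).const_mul C₀) (hv.const_mul C₀)
    have hy : SpaceC (-1) fun t => C₀ * ivpSolution t := spaceC_ivpSolution.const_mul C₀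
    have hlim : Tendsto ivpIntegral (𝓝[>] (0:ℝ)) (𝓝 1) := by
      have h := continuous_ivpIntegral.tendsto 0
      rw [ivpIntegral_zero] at h
      exact h.mono_left nhdsWithin_le_nhds
    refine ⟨fun t => C₀ * ivpSolution t, ⟨hy, by rwa [e3]⟩, ⟨hy, by rwa [e5]⟩, fun x hx => ?_,
      ?_, ?_⟩
    · rw [hilferD, hilferD, zero_mul, zero_mul, e3, e5, RL_zero, RL_zero, hD3 x hx, hD5 x hx,
        sub_self]
    · have h := hlim.const_mul C₀
      rw [mul_one] at h
      exact h.congr' (eventually_mem_nhdsWithin.mono fun x hx => (h3 x hx).symm)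
    · have h := (hlim.sub_const 1).const_mul C₀
      rw [sub_self, mul_zero] at h
      exact h.congr' (eventually_mem_nhdsWithin.mono fun x hx => (h5 x hx).symm)
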